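/- Let (V, ω) be a VOA of CFT type and let a ∈ CV be a conformal vector of V. Then pr_1(a) ∈ J_1(V), and exp(−pr_1(a)(1)) a ∈ V_{≥2} ∩ CV. -/

import Mathlib

/-!
Common framework: vertex algebras, ℤ-graded (conformal) vertex algebras,
conformal vectors, automorphism groups, following Moriwaki,
"On classification of conformal vectors in vertex operator algebra and
the vertex algebra automorphism group".
-/

noncomputable section

open scoped BigOperators

/-- The generalized binomial coefficient `binom(m, i)` for `m : ℤ`, valued in a field `K`. -/
def zBinom (K : Type*) [Field K] (m : ℤ) (i : ℕ) : K :=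
  (∏ j ∈ Finset.range i, ((m : K) - (j : K))) / (Nat.factorial i : K)

/-- A vertex algebra over a field `K`: a `K`-vector space `V` equipped with bilinear
`n`-th products `a(n)b` (`n : ℤ`) and a vacuum vector `𝟙`, subject to the truncation
condition, the vacuum and creation axioms, and the Borcherds identity. -/
structure VA (K V : Type*) [Field K] [AddCommGroup V] [Module K V] where
  /-- the `n`-th product `a(n)b`, bilinear in `a` and `b` -/
  ncoef : ℤ → V →ₗ[K] V →ₗ[K] V
  /-- the vacuum vector `𝟙` -/
  vac : V
  /-- truncation: `a(n)b = 0` for `n` sufficiently large -/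
  trunc : ∀ a b : V, ∃ N : ℤ, ∀ n : ℤ, N ≤ n → ncoef n a b = 0
  /-- the vacuum axiom `Y(𝟙, z) = id`, i.e. `𝟙(n)a = δ_{n,-1} a` -/
  vac_ncoef : ∀ (n : ℤ) (a : V), ncoef n vac a = if n = -1 then a else 0
  /-- creation: `a(-1)𝟙 = a` -/
  ncoef_vac : ∀ a : V, ncoef (-1) a vac = a
  /-- creation: `a(n)𝟙 = 0` for `n ≥ 0` -/
  ncoef_vac_zero : ∀ n : ℤ, 0 ≤ n → ∀ a : V, ncoef n a vac = 0
  /-- the Borcherds identity -/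
  borcherds : ∀ (a b c : V) (p q m : ℤ),
    (∑ᶠ i : ℕ, zBinom K m i •
        ncoef (m + q - (i : ℤ)) (ncoef (p + (i : ℤ)) a b) c)
      = ∑ᶠ i : ℕ, ((-1 : K) ^ i * zBinom K p i) •
          (ncoef (m + p - (i : ℤ)) a (ncoef (q + (i : ℤ)) b c)
            - ((p.negOnePow : ℤ) : K) •
                ncoef (p + q - (i : ℤ)) b (ncoef (m + (i : ℤ)) a c))

namespace VA

variable {K V : Type*} [Field K] [AddCommGroup V] [Module K V]

/-- The translation operator `T a = a(-2)𝟙`. -/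
def T (A : VA K V) : V →ₗ[K] V := (A.ncoef (-2)).flip A.vac

/-- The eigenspace `V_n^a = {v ∈ V | a(1)v = n v}` of `a(1)`. -/
def eig (A : VA K V) (a : V) (n : ℤ) : Submodule K V :=
  LinearMap.ker (A.ncoef 1 a - (n : K) • (LinearMap.id : V →ₗ[K] V))

/-- `a` is a conformal vector: `a(1)a = 2a`, `a(3)a ∈ K𝟙`, `a(2)a = 0`, `a(n)a = 0`
for `n ≥ 4`, `a(0) = T`, and `a(1)` is semisimple with integer eigenvalues
(`V = ⊕_{n ∈ ℤ} V_n^a`). -/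
def IsConformal (A : VA K V) (a : V) : Prop :=
  A.ncoef 1 a a = (2 : K) • a ∧
  (∃ c : K, A.ncoef 3 a a = c • A.vac) ∧
  A.ncoef 2 a a = 0 ∧
  (∀ n : ℤ, 4 ≤ n → A.ncoef n a a = 0) ∧
  A.ncoef 0 a = A.T ∧
  DirectSum.IsInternal (A.eig a)

/-- `a` is a conformal vector of CFT type: `(V, a)` is a VOA of CFT type, i.e.
`V = ⊕_{n ∈ ℕ} V_n^a` with finite-dimensional pieces and `V_0^a = K𝟙`. -/
def IsConformalCFT (A : VA K V) (a : V) : Prop :=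
  A.IsConformal a ∧
  (∀ n : ℤ, n < 0 → A.eig a n = ⊥) ∧
  (∀ n : ℤ, FiniteDimensional K (A.eig a n)) ∧
  A.eig a 0 = Submodule.span K {A.vac}

/-- `a` is a conformal vector of strong CFT type: of CFT type and `a(2)V_1^a = 0`
(i.e. `L^a(1) V_1^a = 0`). -/
def IsConformalSCFT (A : VA K V) (a : V) : Prop :=
  A.IsConformalCFT a ∧ ∀ v ∈ A.eig a 1, A.ncoef 2 a v = 0

/-- A vertex algebra homomorphism: a linear map preserving all products and the vacuum. -/
structure IsVAHom (A : VA K V) (f : V → V) : Prop where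
  map_add : ∀ a b : V, f (a + b) = f a + f b
  map_smul : ∀ (c : K) (a : V), f (c • a) = c • f a
  map_ncoef : ∀ (n : ℤ) (a b : V), f (A.ncoef n a b) = A.ncoef n (f a) (f b)
  map_vac : f A.vac = A.vac

/-- A vertex algebra automorphism: a bijective vertex algebra homomorphism. -/
def IsVAAut (A : VA K V) (f : V → V) : Prop :=
  A.IsVAHom f ∧ Function.Bijective f

/-- A (two-sided) ideal of a vertex algebra. -/
def IsIdeal (A : VA K V) (I : Submodule K V) : Prop :=
  ∀ (n : ℤ) (a : V), ∀ b ∈ I, A.ncoef n a b ∈ I ∧ A.ncoef n b a ∈ I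

/-- A vertex algebra is simple if it has no ideals other than `0` and itself. -/
def IsSimple (A : VA K V) : Prop :=
  ∀ I : Submodule K V, A.IsIdeal I → I = ⊥ ∨ I = ⊤

end VA

/-- The exponential `exp f = Σ_{n≥0} f^n / n!` of an endomorphism, as a function
(meaningful for locally nilpotent `f`). -/
def expOp {K V : Type*} [Field K] [AddCommGroup V] [Module K V]
    (f : V →ₗ[K] V) (v : V) : V :=
  ∑ᶠ n : ℕ, (Nat.factorial n : K)⁻¹ • (f ^ n) v

/-- A ℤ-grading on a vertex algebra, making it a ℤ-graded vertex algebra: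
`V = ⊕_{n ∈ ℤ} V_n`, `V_n(k)V_m ⊆ V_{n+m-k-1}` and `𝟙 ∈ V_0`. -/
structure GradedVA {K V : Type*} [Field K] [AddCommGroup V] [Module K V] (A : VA K V) where
  /-- the grading subspaces `V_n` -/
  gr : ℤ → Submodule K V
  /-- `V = ⊕_{n ∈ ℤ} V_n` -/
  decomp : DirectSum.Decomposition gr
  /-- `𝟙 ∈ V_0` -/
  vac_mem : A.vac ∈ gr 0
  /-- `V_n(k)V_m ⊆ V_{n+m-k-1}` -/
  ncoef_mem : ∀ (n m k : ℤ), ∀ a ∈ gr n, ∀ b ∈ gr m, A.ncoef k a b ∈ gr (n + m - k - 1)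

namespace GradedVA

variable {K V : Type*} [Field K] [AddCommGroup V] [Module K V] {A : VA K V}

/-- The canonical projection `pr_n : V → V_n`. -/
def pr (G : GradedVA A) (n : ℤ) (v : V) : V :=
  letI := G.decomp
  (DirectSum.decompose G.gr v n : V)

/-- `V_{≥n} = ⊕_{i ≥ n} V_i`. -/
def ge (G : GradedVA A) (n : ℤ) : Submodule K V := ⨆ i ≥ n, G.gr i

/-- `V_{≤n} = ⊕_{i ≤ n} V_i`. -/
def le (G : GradedVA A) (n : ℤ) : Submodule K V := ⨆ i ≤ n, G.gr i

/-- `J_1(V) = {a ∈ V_1 | a(0) = 0}`. -/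
def J1 (G : GradedVA A) : Set V :=
  {a : V | a ∈ G.gr 1 ∧ A.ncoef 0 a = 0}

/-- `Aut⁺V`: automorphisms `f` with `f(V_n) ⊆ V_{≥n}` and `pr_n ∘ f|_{V_n} = id`. -/
def AutPlus (G : GradedVA A) (f : V → V) : Prop :=
  A.IsVAAut f ∧ ∀ n : ℤ, ∀ v ∈ G.gr n, f v ∈ G.ge n ∧ G.pr n (f v) = v

/-- `Aut⁻V`: automorphisms `f` with `f(V_n) ⊆ ⊕_{k ≤ n} V_k` and `pr_n ∘ f|_{V_n} = id`. -/
def AutMinus (G : GradedVA A) (f : V → V) : Prop :=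
  A.IsVAAut f ∧ ∀ n : ℤ, ∀ v ∈ G.gr n, f v ∈ G.le n ∧ G.pr n (f v) = v

/-- `Aut⁰V`: automorphisms `f` with `f(V_n) ⊆ V_n`. -/
def AutZero (G : GradedVA A) (f : V → V) : Prop :=
  A.IsVAAut f ∧ ∀ n : ℤ, ∀ v ∈ G.gr n, f v ∈ G.gr n

end GradedVA

/-- A ℤ-graded conformal vertex algebra: a ℤ-graded vertex algebra with a conformal
vector `ω ∈ V_2` whose modes `L(n) = ω(n+1)` satisfy the Virasoro relations, with
`L(0)v = n v` for `v ∈ V_n` and `L(-1) = T`. -/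
structure ConfGVA {K V : Type*} [Field K] [AddCommGroup V] [Module K V] (A : VA K V)
    extends GradedVA A where
  /-- the conformal vector -/
  ω : V
  ω_mem : ω ∈ gr 2
  /-- the Virasoro relations `[L(n), L(m)] = (n-m)L(n+m) + δ_{n+m,0}((n³-n)/12)c` -/
  virasoro : ∃ c : K, ∀ n m : ℤ,
    A.ncoef (n + 1) ω ∘ₗ A.ncoef (m + 1) ω - A.ncoef (m + 1) ω ∘ₗ A.ncoef (n + 1) ω
      = ((n : K) - (m : K)) • A.ncoef (n + m + 1) ω
        + (if n + m = 0 then ((n : K) ^ 3 - (n : K)) / 12 * c else 0)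
            • (LinearMap.id : V →ₗ[K] V)
  /-- `L(0) v = n v` for `v ∈ V_n` -/
  L0_grading : ∀ n : ℤ, ∀ v ∈ gr n, A.ncoef 1 ω v = (n : K) • v
  /-- `L(-1) = T` -/
  Lneg1_eq_T : A.ncoef 0 ω = A.T

namespace ConfGVA

variable {K V : Type*} [Field K] [AddCommGroup V] [Module K V] {A : VA K V}

abbrev pr (C : ConfGVA A) : ℤ → V → V := C.toGradedVA.pr
abbrev ge (C : ConfGVA A) : ℤ → Submodule K V := C.toGradedVA.ge
abbrev le (C : ConfGVA A) : ℤ → Submodule K V := C.toGradedVA.le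
abbrev J1 (C : ConfGVA A) : Set V := C.toGradedVA.J1
abbrev AutPlus (C : ConfGVA A) : (V → V) → Prop := C.toGradedVA.AutPlus
abbrev AutMinus (C : ConfGVA A) : (V → V) → Prop := C.toGradedVA.AutMinus
abbrev AutZero (C : ConfGVA A) : (V → V) → Prop := C.toGradedVA.AutZero

/-- `Aut_ω V`: the VOA automorphisms, i.e. the stabilizer of `ω` in `Aut V`. -/
def AutOmega (C : ConfGVA A) (f : V → V) : Prop :=
  A.IsVAAut f ∧ f C.ω = C.ω

/-- An invariant bilinear form on `(V, ω)`:
`(a(n)b, c) = (-1)^d Σ_{j≥0} (1/j!) (b, (L(1)^j a)(2d-n-2-j) c)` for `a ∈ V_d`, which is the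
coefficient form of `(Y(a,z)b, c) = (b, Y(e^{zL(1)}(-z^{-2})^{L(0)} a, z^{-1}) c)`. -/
def IsInvForm (C : ConfGVA A) (B : V →ₗ[K] V →ₗ[K] K) : Prop :=
  ∀ d : ℤ, ∀ a ∈ C.gr d, ∀ (b c : V) (n : ℤ),
    B (A.ncoef n a b) c
      = ((d.negOnePow : ℤ) : K) *
          ∑ᶠ j : ℕ, (Nat.factorial j : K)⁻¹ *
            B b (A.ncoef (2 * d - n - 2 - (j : ℤ)) ((A.ncoef 2 C.ω ^ j) a) c)

end ConfGVA

/-- A VOA of CFT type: a ℤ-graded conformal vertex algebra with `V = ⊕_{n ∈ ℕ} V_n`,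
`dim V_n < ∞`, and `V_0 = K𝟙`. -/
structure VOACFT {K V : Type*} [Field K] [AddCommGroup V] [Module K V] (A : VA K V)
    extends ConfGVA A where
  gr_neg : ∀ n : ℤ, n < 0 → gr n = ⊥
  gr_fd : ∀ n : ℤ, FiniteDimensional K (gr n)
  gr_zero : gr 0 = Submodule.span K {A.vac}

namespace VOACFT

variable {K V : Type*} [Field K] [AddCommGroup V] [Module K V] {A : VA K V}

abbrev pr (W : VOACFT A) : ℤ → V → V := W.toConfGVA.pr
abbrev ge (W : VOACFT A) : ℤ → Submodule K V := W.toConfGVA.ge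
abbrev le (W : VOACFT A) : ℤ → Submodule K V := W.toConfGVA.le
abbrev J1 (W : VOACFT A) : Set V := W.toConfGVA.J1
abbrev AutPlus (W : VOACFT A) : (V → V) → Prop := W.toConfGVA.AutPlus
abbrev AutMinus (W : VOACFT A) : (V → V) → Prop := W.toConfGVA.AutMinus
abbrev AutZero (W : VOACFT A) : (V → V) → Prop := W.toConfGVA.AutZero
abbrev AutOmega (W : VOACFT A) : (V → V) → Prop := W.toConfGVA.AutOmega
abbrev IsInvForm (W : VOACFT A) : (V →ₗ[K] V →ₗ[K] K) → Prop := W.toConfGVA.IsInvForm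

end VOACFT

/-- A VOA of strong CFT type: a VOA of CFT type with `L(1)V_1 = 0`. -/
structure VOAsCFT {K V : Type*} [Field K] [AddCommGroup V] [Module K V] (A : VA K V)
    extends VOACFT A where
  L1_V1 : ∀ v ∈ gr 1, A.ncoef 2 ω v = 0

namespace VOAsCFT

variable {K V : Type*} [Field K] [AddCommGroup V] [Module K V] {A : VA K V}

abbrev pr (W : VOAsCFT A) : ℤ → V → V := W.toVOACFT.pr
abbrev ge (W : VOAsCFT A) : ℤ → Submodule K V := W.toVOACFT.ge
abbrev le (W : VOAsCFT A) : ℤ → Submodule K V := W.toVOACFT.le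
abbrev J1 (W : VOAsCFT A) : Set V := W.toVOACFT.J1
abbrev AutPlus (W : VOAsCFT A) : (V → V) → Prop := W.toVOACFT.AutPlus
abbrev AutMinus (W : VOAsCFT A) : (V → V) → Prop := W.toVOACFT.AutMinus
abbrev AutZero (W : VOAsCFT A) : (V → V) → Prop := W.toVOACFT.AutZero
abbrev AutOmega (W : VOAsCFT A) : (V → V) → Prop := W.toVOACFT.AutOmega
abbrev IsInvForm (W : VOAsCFT A) : (V →ₗ[K] V →ₗ[K] K) → Prop := W.toVOACFT.IsInvForm

end VOAsCFT

end

section Binomial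

variable {K : Type*} [Field K]

lemma zBinom_zero_right (m : ℤ) : zBinom K m 0 = 1 := by simp [zBinom]

lemma zBinom_eq_zero_of_lt {n i : ℕ} (h : n < i) : zBinom K (n : ℤ) i = 0 := by
  rw [zBinom, Finset.prod_eq_zero (Finset.mem_range.mpr h) (by simp), zero_div]

lemma zBinom_one_one : zBinom K 1 1 = 1 := by simp [zBinom]

lemma zBinom_neg_one [CharZero K] (i : ℕ) : zBinom K (-1) i = (-1) ^ i := by
  have h : ∏ j ∈ Finset.range i, (((-1 : ℤ) : K) - (j : K)) = (-1) ^ i * (i.factorial : K) := by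
    induction i with
    | zero => simp
    | succ k ih => rw [Finset.prod_range_succ, ih, Nat.factorial_succ]; push_cast; ring
  rw [zBinom, h, mul_div_assoc, div_self (by exact_mod_cast i.factorial_ne_zero), mul_one]

lemma zBinom_neg_two [CharZero K] (i : ℕ) : zBinom K (-2) i = (-1) ^ i * (i + 1) := by
  have h : ∏ j ∈ Finset.range i, (((-2 : ℤ) : K) - (j : K))
      = (-1) ^ i * (i + 1) * (i.factorial : K) := by
    induction i with
    | zero => simp
    | succ k ih => rw [Finset.prod_range_succ, ih, Nat.factorial_succ]; push_cast; ring
  rw [zBinom, h, mul_div_assoc, div_self (by exact_mod_cast i.factorial_ne_zero), mul_one]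

end Binomial

lemma finsum_eq_sum_range {M : Type*} [AddCommMonoid M] {f : ℕ → M} {N : ℕ}
    (h : ∀ i, N ≤ i → f i = 0) : ∑ᶠ i, f i = ∑ i ∈ Finset.range N, f i := by
  refine finsum_eq_sum_of_support_subset f fun i hi ↦ ?_
  by_contra hN
  exact hi (h i (by simpa using hN))

section Exponential

variable {K V : Type*} [Field K] [AddCommGroup V] [Module K V] {f : V →ₗ[K] V}

lemma pow_apply_eq_zero_of_le {v : V} {N n : ℕ} (h : (f ^ N) v = 0) (hn : N ≤ n) :
    (f ^ n) v = 0 := by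
  rw [← Nat.sub_add_cancel hn, pow_add, Module.End.mul_apply, h, map_zero]

lemma expOp_eq_sum {v : V} {N : ℕ} (h : (f ^ N) v = 0) :
    expOp f v = ∑ n ∈ Finset.range N, (Nat.factorial n : K)⁻¹ • (f ^ n) v :=
  finsum_eq_sum_range fun i hi ↦ by rw [pow_apply_eq_zero_of_le h hi, smul_zero]

lemma expOp_of_apply_eq_zero {v : V} (h : f v = 0) : expOp f v = v := by
  rw [expOp_eq_sum (N := 1) (by simpa using h)]
  simp

variable (hf : ∀ v, ∃ N : ℕ, (f ^ N) v = 0)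
include hf

lemma expOp_add (v w : V) : expOp f (v + w) = expOp f v + expOp f w := by
  obtain ⟨N, hN⟩ := hf v
  obtain ⟨M, hM⟩ := hf w
  have h₁ := pow_apply_eq_zero_of_le hN (le_max_left N M)
  have h₂ := pow_apply_eq_zero_of_le hM (le_max_right N M)
  rw [expOp_eq_sum h₁, expOp_eq_sum h₂,
    expOp_eq_sum (v := v + w) (N := max N M) (by rw [map_add, h₁, h₂, add_zero]),
    ← Finset.sum_add_distrib]
  simp

lemma expOp_smul (c : K) (v : V) : expOp f (c • v) = c • expOp f v := by
  obtain ⟨N, hN⟩ := hf v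
  rw [expOp_eq_sum hN, expOp_eq_sum (v := c • v) (N := N) (by rw [map_smul, hN, smul_zero]),
    Finset.smul_sum]
  exact Finset.sum_congr rfl fun i _ ↦ by rw [map_smul, smul_comm]

end Exponential

section ExponentialBijective

variable {K V : Type*} [Field K] [AddCommGroup V] [Module K V] {f : V →ₗ[K] V}

lemma pow_apply_expOp {v : V} {N : ℕ} (h : (f ^ (N + 1)) v = 0) :
    (f ^ N) (expOp f v) = (f ^ N) v := by
  rw [expOp_eq_sum h, Finset.sum_range_succ', map_add, map_sum, Finset.sum_eq_zero]
  · simp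
  · intro i _
    rw [map_smul, ← Module.End.mul_apply, ← pow_add, pow_apply_eq_zero_of_le h (by omega),
      smul_zero]

variable (hf : ∀ v, ∃ N : ℕ, (f ^ N) v = 0)
include hf

lemma expOp_sub (v w : V) : expOp f (v - w) = expOp f v - expOp f w := by
  rw [eq_sub_iff_add_eq, ← expOp_add hf, sub_add_cancel]

lemma expOp_bijective : Function.Bijective (expOp f) := by
  constructor
  · have key : ∀ (N : ℕ) (v : V), (f ^ N) v = 0 → expOp f v = 0 → v = 0 := by
      intro N
      induction N with
      | zero => intro v hv _; simpa using hv
      | succ N ih =>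
        intro v hv h0
        exact ih v (by rw [← pow_apply_expOp hv, h0, map_zero]) h0
    intro v w h
    obtain ⟨N, hN⟩ := hf (v - w)
    exact sub_eq_zero.mp (key N _ hN (by rw [expOp_sub hf, h, sub_self]))
  · have key : ∀ (N : ℕ) (v : V), (f ^ N) v = 0 → ∃ y, expOp f y = v := by
      intro N
      induction N with
      | zero => intro v hv; exact ⟨v, expOp_of_apply_eq_zero (by simp_all)⟩
      | succ N ih =>
        intro v hv
        obtain ⟨y, hy⟩ := ih (v - expOp f v) (by rw [map_sub, pow_apply_expOp hv, sub_self])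
        exact ⟨v + y, by rw [expOp_add hf, hy, add_sub_cancel]⟩
    intro v
    obtain ⟨N, hN⟩ := hf v
    exact key N v hN

end ExponentialBijective

section ExponentialDerivation

variable {K V : Type*} [Field K] [AddCommGroup V] [Module K V] {f : V →ₗ[K] V}
  {B : V →ₗ[K] V →ₗ[K] V} (hB : ∀ a b, f (B a b) = B (f a) b + B a (f b))
include hB

lemma pow_apply_bilin (k : ℕ) (a b : V) :
    (f ^ k) (B a b) = ∑ ij ∈ Finset.HasAntidiagonal.antidiagonal k,
      k.choose ij.1 • B ((f ^ ij.1) a) ((f ^ ij.2) b) := by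
  induction k with
  | zero => simp
  | succ k ih =>
    rw [Finset.sum_antidiagonal_choose_succ_nsmul (fun i j ↦ B ((f ^ i) a) ((f ^ j) b)) k,
      pow_succ', Module.End.mul_apply, ih, map_sum, ← Finset.sum_add_distrib]
    refine Finset.sum_congr rfl fun ij hij ↦ ?_
    rw [map_nsmul, hB, nsmul_add, add_comm, pow_succ', pow_succ', Module.End.mul_apply,
      Module.End.mul_apply,
      Nat.choose_symm_of_eq_add (Finset.HasAntidiagonal.mem_antidiagonal.mp hij).symm]

lemma divPow_apply_bilin [CharZero K] (k : ℕ) (a b : V) :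
    (k.factorial : K)⁻¹ • (f ^ k) (B a b) = ∑ ij ∈ Finset.HasAntidiagonal.antidiagonal k,
      B ((ij.1.factorial : K)⁻¹ • (f ^ ij.1) a) ((ij.2.factorial : K)⁻¹ • (f ^ ij.2) b) := by
  rw [pow_apply_bilin hB, Finset.smul_sum]
  refine Finset.sum_congr rfl fun ⟨i, j⟩ hij ↦ ?_
  obtain rfl : i + j = k := Finset.HasAntidiagonal.mem_antidiagonal.mp hij
  rw [map_smul, map_smul, LinearMap.smul_apply, ← Nat.cast_smul_eq_nsmul K, smul_smul, smul_smul]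
  congr 1
  have h := congrArg (Nat.cast (R := K)) (Nat.add_choose_mul_factorial_mul_factorial i j)
  rw [← Nat.choose_symm_add] at h
  push_cast at h
  have hi : (i.factorial : K) ≠ 0 := by exact_mod_cast i.factorial_ne_zero
  have hj : (j.factorial : K) ≠ 0 := by exact_mod_cast j.factorial_ne_zero
  have hij' : ((i + j).factorial : K) ≠ 0 := by exact_mod_cast (i + j).factorial_ne_zero
  field_simp
  linear_combination h

lemma expOp_bilin [CharZero K] (hf : ∀ v, ∃ N : ℕ, (f ^ N) v = 0) (a b : V) :
    expOp f (B a b) = B (expOp f a) (expOp f b) := by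
  obtain ⟨N, hN⟩ := hf a
  obtain ⟨M, hM⟩ := hf b
  have hzero : ∀ i j, i ∉ Finset.range N ∨ j ∉ Finset.range M →
      B ((i.factorial : K)⁻¹ • (f ^ i) a) ((j.factorial : K)⁻¹ • (f ^ j) b) = 0 := by
    rintro i j (h | h)
    · simp [pow_apply_eq_zero_of_le hN (by simpa using h)]
    · simp [pow_apply_eq_zero_of_le hM (by simpa using h)]
  have hsum : ∀ k, (k.factorial : K)⁻¹ • (f ^ k) (B a b)
      = ∑ ij ∈ Finset.range N ×ˢ Finset.range M with ij.1 + ij.2 = k,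
        B ((ij.1.factorial : K)⁻¹ • (f ^ ij.1) a) ((ij.2.factorial : K)⁻¹ • (f ^ ij.2) b) := by
    intro k
    rw [divPow_apply_bilin hB]
    refine (Finset.sum_subset (fun ij h ↦ ?_) fun ij h h' ↦ ?_).symm
    · simpa using (Finset.mem_filter.mp h).2
    · rw [Finset.HasAntidiagonal.mem_antidiagonal] at h
      refine hzero _ _ (not_and_or.mp fun hm ↦ h' ?_)
      simpa [h] using hm
  have hmaps : ∀ ij ∈ Finset.range N ×ˢ Finset.range M,
      ij.1 + ij.2 ∈ Finset.range (N + M) := by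
    intro ij h
    simp only [Finset.mem_product, Finset.mem_range] at h ⊢
    omega
  rw [expOp_eq_sum hN, expOp_eq_sum hM, expOp, finsum_eq_sum_range (N := N + M),
    Finset.sum_congr rfl fun k _ ↦ hsum k, Finset.sum_fiberwise_of_maps_to hmaps,
    Finset.sum_product]
  · simp only [map_sum, LinearMap.sum_apply]
    rw [Finset.sum_comm]
  · intro k hk
    rw [hsum, Finset.sum_eq_zero]
    intro ij h
    have := hmaps ij (Finset.mem_filter.mp h).1
    have := (Finset.mem_filter.mp h).2
    simp only [Finset.mem_range] at *
    omega

end ExponentialDerivation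

namespace VA

variable {K V : Type*} [Field K] [AddCommGroup V] [Module K V] (A : VA K V)

lemma T_apply (v : V) : A.T v = A.ncoef (-2) v A.vac := rfl

lemma T_vac : A.T A.vac = 0 := by simp [T_apply, A.vac_ncoef]

/-- Only the term `i = 0` survives on the right-hand side of the Borcherds identity
when `p = 0`. -/
lemma borcherds_zero (a b c : V) (q m : ℤ) :
    (∑ᶠ i : ℕ, zBinom K m i • A.ncoef (m + q - (i : ℤ)) (A.ncoef (i : ℤ) a b) c)
      = A.ncoef m a (A.ncoef q b c) - A.ncoef q b (A.ncoef m a c) := by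
  have h := A.borcherds a b c 0 q m
  simp only [zero_add] at h
  rw [h, finsum_eq_single _ 0]
  · simp [zBinom_zero_right]
  · intro i hi
    have : zBinom K 0 i = 0 := zBinom_eq_zero_of_lt (n := 0) (by omega)
    simp [this]

lemma ncoef_zero_ncoef (a b c : V) (q : ℤ) :
    A.ncoef 0 a (A.ncoef q b c) = A.ncoef q (A.ncoef 0 a b) c + A.ncoef q b (A.ncoef 0 a c) := by
  have h := A.borcherds_zero a b c q 0
  rw [finsum_eq_sum_range (N := 1)] at h
  · rw [← sub_eq_iff_eq_add, ← h]
    simp [zBinom_zero_right]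
  · intro i hi
    have : zBinom K 0 i = 0 := zBinom_eq_zero_of_lt (n := 0) (by omega)
    simp [this]

lemma ncoef_one_ncoef {a : V} (ha : A.ncoef 0 a = 0) (b c : V) (q : ℤ) :
    A.ncoef 1 a (A.ncoef q b c) = A.ncoef q (A.ncoef 1 a b) c + A.ncoef q b (A.ncoef 1 a c) := by
  have h := A.borcherds_zero a b c q 1
  rw [finsum_eq_sum_range (N := 2)] at h
  · rw [← sub_eq_iff_eq_add, ← h]
    simp [Finset.sum_range_succ, zBinom_one_one, ha]
  · intro i hi
    have : zBinom K 1 i = 0 := zBinom_eq_zero_of_lt (n := 1) (by omega)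
    simp [this]

/-- Skew-symmetry, with `x(-1-i)𝟙` in place of `T^i x / i!`. -/
lemma ncoef_skew [CharZero K] (a b : V) (p : ℤ) :
    A.ncoef p b a = -((p.negOnePow : ℤ) : K) •
      ∑ᶠ i : ℕ, (-1 : K) ^ i • A.ncoef (-1 - (i : ℤ)) (A.ncoef (p + i) a b) A.vac := by
  have h := A.borcherds a b A.vac p 0 (-1)
  simp only [add_zero, zero_add, zBinom_neg_one] at h
  rw [h, finsum_eq_single _ 0]
  · rcases Int.even_or_odd p with hp | hp
    · simp [zBinom_zero_right, A.ncoef_vac_zero, A.ncoef_vac, Int.negOnePow_even p hp]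
    · simp [zBinom_zero_right, A.ncoef_vac_zero, A.ncoef_vac, Int.negOnePow_odd p hp]
  · intro i hi
    rw [A.ncoef_vac_zero i (by omega), A.ncoef_vac_zero (-1 + i) (by omega)]
    simp

lemma ncoef_T [CharZero K] (x c : V) (q : ℤ) :
    A.ncoef q (A.T x) c = -(q : K) • A.ncoef (q - 1) x c := by
  have h := A.borcherds x A.vac c (-2) q 0
  rw [finsum_eq_single _ 0] at h
  · simp only [Nat.cast_zero, add_zero, zero_add, sub_zero, zBinom_zero_right, one_smul] at h
    rw [T_apply, h]
    simp only [zBinom_neg_two, A.vac_ncoef]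
    rcases lt_trichotomy q 0 with hq | rfl | hq
    · obtain ⟨n, rfl⟩ : ∃ n : ℕ, q = -1 - n := ⟨(-1 - q).toNat, by omega⟩
      rw [finsum_eq_single _ n]
      · rw [if_pos (by ring), if_neg (by omega), smul_zero, sub_zero, ← mul_assoc, ← mul_pow]
        rw [show (-2 - (n : ℤ)) = -1 - n - 1 by ring]
        congr 1
        push_cast
        simp
      · intro i hi
        rw [if_neg (by omega), if_neg (by omega)]
        simp
    · rw [finsum_eq_zero_of_forall_eq_zero]
      · simp
      · intro i
        rw [if_neg (by omega), if_neg (by omega)]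
        simp
    · obtain ⟨n, rfl⟩ : ∃ n : ℕ, q = n + 1 := ⟨(q - 1).toNat, by omega⟩
      rw [finsum_eq_single _ n]
      · rw [if_neg (by omega), if_pos (by ring), map_zero, zero_sub, ← mul_assoc, ← mul_pow]
        rw [show ((n : ℤ) + 1 - 1) = n by ring]
        rw [show Int.negOnePow (-2) = 1 from rfl]
        simp
        module
      · intro i hi
        rw [if_neg (by omega), if_neg (by omega)]
        simp
  · intro i hi
    have : zBinom K 0 i = 0 := zBinom_eq_zero_of_lt (n := 0) (by omega)
    simp [this]

variable {A}

lemma IsVAHom.map_T {f : V → V} (hf : A.IsVAHom f) (v : V) : f (A.T v) = A.T (f v) := by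
  rw [T_apply, T_apply, hf.map_ncoef, hf.map_vac]

lemma mem_eig {a v : V} {n : ℤ} : v ∈ A.eig a n ↔ A.ncoef 1 a v = (n : K) • v := by
  simp [eig, sub_eq_zero]

lemma IsVAAut.isConformal {f : V → V} (hf : A.IsVAAut f) {a : V} (ha : A.IsConformal a) :
    A.IsConformal (f a) := by
  obtain ⟨hf, hbij⟩ := hf
  obtain ⟨h1, ⟨c, h3⟩, h2, h4, h0, hint⟩ := ha
  have hf0 : f 0 = 0 := by simpa using hf.map_smul 0 0
  refine ⟨?_, ⟨c, ?_⟩, ?_, fun n hn ↦ ?_, ?_, ?_⟩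
  · rw [← hf.map_ncoef, h1, hf.map_smul]
  · rw [← hf.map_ncoef, h3, hf.map_smul, hf.map_vac]
  · rw [← hf.map_ncoef, h2, hf0]
  · rw [← hf.map_ncoef, h4 n hn, hf0]
  · ext v
    obtain ⟨w, rfl⟩ := hbij.2 v
    rw [← hf.map_ncoef, h0, hf.map_T]
  · let e : V ≃ₗ[K] V :=
      LinearEquiv.ofBijective ⟨⟨f, hf.map_add⟩, hf.map_smul⟩ hbij
    have heig : A.eig (f a) = fun n ↦ (A.eig a n).map (e : V →ₗ[K] V) := by
      ext n v
      obtain ⟨w, rfl⟩ := hbij.2 v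
      have he : e w = f w := rfl
      rw [← he, Submodule.mem_map_equiv, e.symm_apply_apply, mem_eig, mem_eig, he,
        ← hf.map_ncoef, ← hf.map_smul, hbij.1.eq_iff]
    rw [DirectSum.isInternal_submodule_iff_iSupIndep_and_iSup_eq_top] at hint ⊢
    rw [heig]
    refine ⟨hint.1.map_orderIso (Submodule.orderIsoMapComap e), ?_⟩
    rw [← Submodule.map_iSup, hint.2, Submodule.map_top, LinearEquiv.range]

end VA

namespace GradedVA

variable {K V : Type*} [Field K] [AddCommGroup V] [Module K V] {A : VA K V} (G : GradedVA A)

lemma pr_mem (n : ℤ) (v : V) : G.pr n v ∈ G.gr n :=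
  let _ := G.decomp
  (DirectSum.decompose G.gr v n).2

lemma pr_of_mem {n : ℤ} {v : V} (h : v ∈ G.gr n) : G.pr n v = v :=
  let _ := G.decomp
  DirectSum.decompose_of_mem_same G.gr h

lemma pr_of_mem_ne {n m : ℤ} {v : V} (h : v ∈ G.gr n) (hne : n ≠ m) : G.pr m v = 0 :=
  let _ := G.decomp
  DirectSum.decompose_of_mem_ne G.gr h hne

lemma pr_add (n : ℤ) (v w : V) : G.pr n (v + w) = G.pr n v + G.pr n w := by
  let _ := G.decomp
  simp [pr, DirectSum.decompose_add]

lemma pr_sub (n : ℤ) (v w : V) : G.pr n (v - w) = G.pr n v - G.pr n w := by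
  rw [eq_sub_iff_add_eq, ← pr_add, sub_add_cancel]

lemma pr_zero (n : ℤ) : G.pr n 0 = 0 := G.pr_of_mem (zero_mem _)

lemma exists_eq_sum_pr (v : V) : ∃ s : Finset ℤ, v = ∑ i ∈ s, G.pr i v := by
  classical
  let _ := G.decomp
  exact ⟨_, (DirectSum.sum_support_decompose G.gr v).symm⟩

lemma induction_on {p : V → Prop} (hom : ∀ n, ∀ v ∈ G.gr n, p v)
    (add : ∀ v w, p v → p w → p (v + w)) (v : V) : p v := by
  obtain ⟨s, hs⟩ := G.exists_eq_sum_pr v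
  rw [hs]
  exact Finset.sum_induction _ p add (hom 0 0 (zero_mem _)) fun i _ ↦ hom i _ (G.pr_mem i v)

lemma pr_ncoef {m : ℤ} {w : V} (hw : w ∈ G.gr m) (k i n : ℤ) (hn : n = i + m - k - 1) (v : V) :
    G.pr n (A.ncoef k v w) = A.ncoef k (G.pr i v) w := by
  subst hn
  induction v using G.induction_on with
  | hom j v hv =>
    have hmem := G.ncoef_mem j m k v hv w hw
    by_cases h : j = i
    · subst h
      rw [G.pr_of_mem hv, G.pr_of_mem hmem]
    · rw [G.pr_of_mem_ne hv h, G.pr_of_mem_ne hmem (by omega), map_zero, LinearMap.zero_apply]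
  | add v v' hv hv' =>
    rw [map_add, LinearMap.add_apply, pr_add, hv, hv', pr_add, map_add, LinearMap.add_apply]

/-- The homogeneous components of a vector `v` with `v(0) = 0` inherit this property. -/
lemma ncoef_zero_pr {v : V} (hv : A.ncoef 0 v = 0) (i : ℤ) : A.ncoef 0 (G.pr i v) = 0 := by
  ext w
  induction w using G.induction_on with
  | hom m w hw => rw [← G.pr_ncoef hw 0 i _ rfl, hv, LinearMap.zero_apply, pr_zero]
  | add w w' hw hw' => rw [map_add, map_add, hw, hw']

lemma T_mem {n : ℤ} {v : V} (hv : v ∈ G.gr n) : A.T v ∈ G.gr (n + 1) := by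
  have h := G.ncoef_mem n 0 (-2) v hv A.vac G.vac_mem
  rwa [show n + 0 - -2 - 1 = n + 1 by ring] at h

end GradedVA

namespace ConfGVA

variable {K V : Type*} [Field K] [AddCommGroup V] [Module K V] {A : VA K V} (C : ConfGVA A)
include C

lemma T_ncoef_vac [CharZero K] (x : V) (n : ℤ) :
    A.T (A.ncoef n x A.vac) = -(n : K) • A.ncoef (n - 1) x A.vac := by
  rw [← C.Lneg1_eq_T, A.ncoef_zero_ncoef, C.Lneg1_eq_T, A.T_vac, map_zero, add_zero, A.ncoef_T]

lemma ncoef_vac_eq_T [CharZero K] (x : V) (i : ℕ) :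
    A.ncoef (-1 - (i + 1 : ℤ)) x A.vac
      = A.T (((i : K) + 1)⁻¹ • A.ncoef (-1 - (i : ℤ)) x A.vac) := by
  have hi : (i : K) + 1 ≠ 0 := by exact_mod_cast i.succ_ne_zero
  rw [map_smul, C.T_ncoef_vac, smul_smul]
  push_cast
  rw [show -(-1 - (i : K)) = i + 1 by ring, inv_mul_cancel₀ hi, one_smul,
    show -1 - ((i : ℤ) + 1) = -1 - i - 1 by ring]

/-- The translation operator is injective on `V_n` for `n ≠ 0`. -/
lemma eq_zero_of_T_eq_zero [CharZero K] {n : ℤ} (hn : n ≠ 0) {v : V} (hv : v ∈ C.gr n)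
    (hT : A.T v = 0) : v = 0 := by
  have hmode : ∀ k : ℤ, k ≠ -1 → A.ncoef k v = 0 := by
    intro k hk
    ext c
    have h := A.ncoef_T v c (k + 1)
    have hk' : ((k + 1 : ℤ) : K) ≠ 0 := by exact_mod_cast fun h ↦ hk (by omega)
    rw [hT, map_zero, LinearMap.zero_apply, add_sub_cancel_right, eq_comm, smul_eq_zero] at h
    exact h.resolve_left (neg_ne_zero.mpr hk')
  have h := C.L0_grading n v hv
  rw [A.ncoef_skew, finsum_eq_zero_of_forall_eq_zero, smul_zero, eq_comm, smul_eq_zero] at h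
  · exact h.resolve_left (by exact_mod_cast hn)
  · intro i
    rw [hmode (1 + i) (by omega)]
    simp

/-- In weight `n ≠ 0, 1`, a vector with vanishing zero mode is a total derivative. -/
lemma exists_eq_T [CharZero K] {n : ℤ} (hn : n ≠ 0) (hn1 : n ≠ 1) {b : V} (hb : b ∈ C.gr n)
    (hb0 : A.ncoef 0 b = 0) : ∃ y, b = A.T y := by
  have hmem : ∀ i : ℕ, A.ncoef (-1 - ((i + 2 : ℕ) : ℤ)) (A.ncoef ((i + 2 : ℕ) : ℤ) C.ω b) A.vac
      ∈ ((C.gr (n - 1)).map A.T).map A.T := by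
    intro i
    have h1 : A.ncoef ((i + 2 : ℕ) : ℤ) C.ω b ∈ C.gr (n - 1 - i) := by
      have h := C.ncoef_mem 2 n ((i + 2 : ℕ) : ℤ) C.ω C.ω_mem b hb
      rwa [show 2 + n - ((i + 2 : ℕ) : ℤ) - 1 = n - 1 - i by push_cast; ring] at h
    have h2 := C.ncoef_mem (n - 1 - i) 0 (-1 - i) _ h1 A.vac C.vac_mem
    rw [show n - 1 - i + 0 - (-1 - (i : ℤ)) - 1 = n - 1 by ring] at h2
    have e1 := C.ncoef_vac_eq_T (A.ncoef ((i + 2 : ℕ) : ℤ) C.ω b) (i + 1)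
    have e2 := C.ncoef_vac_eq_T (A.ncoef ((i + 2 : ℕ) : ℤ) C.ω b) i
    rw [show (-1 - (((i + 1 : ℕ) : ℤ) + 1)) = -1 - ((i + 2 : ℕ) : ℤ) by push_cast; ring,
      show (-1 - ((i + 1 : ℕ) : ℤ)) = -1 - ((i : ℤ) + 1) by push_cast; ring, e2] at e1
    rw [e1]
    exact Submodule.mem_map_of_mem (Submodule.smul_mem _ _
      (Submodule.mem_map_of_mem (Submodule.smul_mem _ _ h2)))
  obtain ⟨N, hN⟩ := A.trunc C.ω b
  have hskew := A.ncoef_skew C.ω b 0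
  rw [hb0, LinearMap.zero_apply, finsum_eq_sum_range (N := N.toNat + 2) fun i hi ↦ by
      rw [hN (0 + i) (by omega), map_zero, LinearMap.zero_apply, smul_zero],
    Finset.sum_range_succ', Finset.sum_range_succ'] at hskew
  simp only [zero_add] at hskew
  have hsum : ∑ k ∈ Finset.range N.toNat, (-1 : K) ^ (k + 1 + 1) •
      A.ncoef (-1 - ((k + 1 + 1 : ℕ) : ℤ)) (A.ncoef ((k + 1 + 1 : ℕ) : ℤ) C.ω b) A.vac
      ∈ ((C.gr (n - 1)).map A.T).map A.T :=
    Submodule.sum_mem _ fun i _ ↦ Submodule.smul_mem _ _ (hmem i)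
  obtain ⟨_, ⟨y, hy, rfl⟩, hTy⟩ := hsum
  rw [← hTy] at hskew
  have hL0 : A.ncoef (-1 - ((1 : ℕ) : ℤ)) (A.ncoef ((1 : ℕ) : ℤ) C.ω b) A.vac
      = (n : K) • A.T b := by
    rw [Nat.cast_one, C.L0_grading n b hb, map_smul]
    rfl
  have hL1 : A.ncoef (-1 - ((0 : ℕ) : ℤ)) (A.ncoef ((0 : ℕ) : ℤ) C.ω b) A.vac = A.T b := by
    rw [Nat.cast_zero, C.Lneg1_eq_T, sub_zero, A.ncoef_vac]
  rw [hL0, hL1] at hskew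
  have hz : A.T (A.T y - ((n : K) - 1) • b) = 0 := by
    simp only [Int.negOnePow_zero, Units.val_one, Int.cast_one, pow_one, pow_zero] at hskew
    rw [map_sub, map_smul]
    refine neg_eq_zero.mp (Eq.trans ?_ hskew.symm)
    module
  have hTy' : A.T y ∈ C.gr n := by simpa using C.T_mem hy
  have hb' := C.eq_zero_of_T_eq_zero hn
    (Submodule.sub_mem _ hTy' (Submodule.smul_mem _ ((n : K) - 1) hb)) hz
  have hn' : (n : K) - 1 ≠ 0 := sub_ne_zero.mpr (by exact_mod_cast hn1)
  exact ⟨((n : K) - 1)⁻¹ • y, by rw [map_smul, sub_eq_zero.mp hb', inv_smul_smul₀ hn']⟩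

end ConfGVA

namespace VOACFT

variable {K V : Type*} [Field K] [AddCommGroup V] [Module K V] {A : VA K V} (W : VOACFT A)
include W

lemma eq_zero_of_neg {n : ℤ} (hn : n < 0) {v : V} (hv : v ∈ W.gr n) : v = 0 := by
  rwa [W.gr_neg n hn, Submodule.mem_bot] at hv

lemma exists_eq_smul_vac {v : V} (hv : v ∈ W.gr 0) : ∃ c : K, v = c • A.vac := by
  rw [W.gr_zero, Submodule.mem_span_singleton] at hv
  exact hv.imp fun _ h ↦ h.symm

lemma ncoef_of_mem_zero {v : V} (hv : v ∈ W.gr 0) {n : ℤ} (hn : n ≠ -1) : A.ncoef n v = 0 := by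
  obtain ⟨c, rfl⟩ := W.exists_eq_smul_vac hv
  ext w
  simp [A.vac_ncoef, hn]

lemma ncoef_apply_of_mem_zero {v : V} (hv : v ∈ W.gr 0) {n : ℤ} (hn : 0 ≤ n) (a : V) :
    A.ncoef n a v = 0 := by
  obtain ⟨c, rfl⟩ := W.exists_eq_smul_vac hv
  rw [map_smul, A.ncoef_vac_zero n hn, smul_zero]

lemma gr_le_ge {n m : ℤ} (h : n ≤ m) : W.gr m ≤ W.ge n :=
  le_iSup₂_of_le (f := fun i (_ : i ≥ n) ↦ W.gr i) m h le_rfl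

lemma T_mem_ge_two (v : V) : A.T v ∈ W.ge 2 := by
  induction v using W.toGradedVA.induction_on with
  | hom n v hv =>
    rcases lt_trichotomy n 0 with h | rfl | h
    · rw [W.eq_zero_of_neg h hv, map_zero]
      exact zero_mem _
    · rw [VA.T_apply, W.ncoef_of_mem_zero hv (by norm_num), LinearMap.zero_apply]
      exact zero_mem _
    · exact W.gr_le_ge (by omega) (W.T_mem hv)
  | add v w hv hw =>
    rw [map_add]
    exact add_mem hv hw

/-- The degree zero part of `a(1)w` is governed by the weight one components. -/
lemma pr_zero_ncoef_one (a w : V) :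
    W.toGradedVA.pr 0 (A.ncoef 1 a w) = A.ncoef 1 (W.toGradedVA.pr 1 a) (W.toGradedVA.pr 1 w) := by
  induction w using W.toGradedVA.induction_on with
  | hom j w hw =>
    by_cases hj : j = 1
    · subst hj
      rw [W.toGradedVA.pr_ncoef hw 1 1 0 (by ring), W.toGradedVA.pr_of_mem hw]
    · rw [W.toGradedVA.pr_ncoef hw 1 (2 - j) 0 (by ring), W.toGradedVA.pr_of_mem_ne hw hj, map_zero]
      have hp := W.toGradedVA.pr_mem (2 - j) a
      rcases lt_or_ge 2 j with h | h
      · rw [W.eq_zero_of_neg (by omega) hp, map_zero, LinearMap.zero_apply]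
      rcases lt_or_ge j 0 with h' | h'
      · rw [W.eq_zero_of_neg h' hw, map_zero]
      rcases (by omega : j = 0 ∨ j = 2) with rfl | rfl
      · rw [W.ncoef_apply_of_mem_zero hw (by norm_num)]
      · rw [W.ncoef_of_mem_zero hp (by norm_num), LinearMap.zero_apply]
  | add w w' hw hw' =>
    rw [map_add, W.toGradedVA.pr_add, hw, hw', W.toGradedVA.pr_add, map_add]

lemma expOp_of_mem_zero (v : V) {w : V} (hw : w ∈ W.gr 0) : expOp (-A.ncoef 1 v) w = w :=
  expOp_of_apply_eq_zero (by
    rw [LinearMap.neg_apply, W.ncoef_apply_of_mem_zero hw zero_le_one, neg_zero])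

section J1

variable {v : V} (hv : v ∈ W.J1)
include hv

lemma neg_ncoef_one_locally_nilpotent (w : V) : ∃ N : ℕ, ((-A.ncoef 1 v) ^ N) w = 0 := by
  induction w using W.toGradedVA.induction_on with
  | hom j w hw =>
    have hmem : ∀ k : ℕ, ((-A.ncoef 1 v) ^ k) w ∈ W.gr (j - k) := by
      intro k
      induction k with
      | zero => simpa using hw
      | succ k ih =>
        rw [pow_succ', Module.End.mul_apply, LinearMap.neg_apply]
        have h := W.ncoef_mem 1 _ 1 v hv.1 _ ih
        rw [show 1 + (j - k) - 1 - 1 = j - ((k + 1 : ℕ) : ℤ) by push_cast; ring] at h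
        exact neg_mem h
    exact ⟨(j + 1).toNat, W.eq_zero_of_neg (by omega) (hmem _)⟩
  | add w w' hw hw' =>
    obtain ⟨N, hN⟩ := hw
    obtain ⟨M, hM⟩ := hw'
    exact ⟨max N M, by rw [map_add, pow_apply_eq_zero_of_le hN (le_max_left N M),
      pow_apply_eq_zero_of_le hM (le_max_right N M), add_zero]⟩

lemma expOp_isVAAut [CharZero K] : A.IsVAAut (expOp (-A.ncoef 1 v)) := by
  have hnil := W.neg_ncoef_one_locally_nilpotent hv
  refine ⟨⟨expOp_add hnil, expOp_smul hnil, fun n ↦ expOp_bilin (fun a b ↦ ?_) hnil, ?_⟩,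
    expOp_bijective hnil⟩
  · simp only [LinearMap.neg_apply, map_neg, A.ncoef_one_ncoef hv.2, neg_add]
  · exact expOp_of_apply_eq_zero (by rw [LinearMap.neg_apply, A.ncoef_vac_zero 1 (by norm_num),
      neg_zero])

lemma ncoef_one_self_mem : A.ncoef 1 v v ∈ W.gr 0 := by
  simpa using W.ncoef_mem 1 1 1 v hv.1 v hv.1

lemma expOp_self [CharZero K] : expOp (-A.ncoef 1 v) v = v - A.ncoef 1 v v := by
  have h := W.ncoef_apply_of_mem_zero (W.ncoef_one_self_mem hv) zero_le_one v
  rw [expOp_eq_sum (N := 2) (by simp [pow_succ, h])]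
  simp [Finset.sum_range_succ, sub_eq_add_neg]

lemma ncoef_one_omega [CharZero K] : A.ncoef 1 v W.ω = v := by
  rw [A.ncoef_skew, finsum_eq_single _ 0]
  · have h := W.L0_grading 1 v hv.1
    simp [A.ncoef_vac, h]
  · intro i hi
    have h := W.ncoef_mem 2 1 (1 + i) W.ω W.ω_mem v hv.1
    rcases (by omega : i = 1 ∨ 2 ≤ i) with rfl | h'
    · rw [W.ncoef_of_mem_zero (by simpa using h) (by norm_num), LinearMap.zero_apply, smul_zero]
    · rw [W.eq_zero_of_neg (by omega) h, map_zero, LinearMap.zero_apply, smul_zero]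

lemma expOp_omega [CharZero K] :
    expOp (-A.ncoef 1 v) W.ω = W.ω - v + (2 : K)⁻¹ • A.ncoef 1 v v := by
  have h := W.ncoef_apply_of_mem_zero (W.ncoef_one_self_mem hv) zero_le_one v
  rw [expOp_eq_sum (N := 3) (by simp [pow_succ, W.ncoef_one_omega hv, h])]
  simp [Finset.sum_range_succ, sub_eq_add_neg, pow_succ, W.ncoef_one_omega hv]

lemma expOp_mem_ge_two [CharZero K] {b : V} (hb : A.ncoef 0 b = 0) (h0 : W.toGradedVA.pr 0 b = 0)
    (h1 : W.toGradedVA.pr 1 b = 0) : expOp (-A.ncoef 1 v) b ∈ W.ge 2 := by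
  have haut := (W.expOp_isVAAut hv).1
  obtain ⟨s, hs⟩ := W.toGradedVA.exists_eq_sum_pr b
  have hzero : expOp (-A.ncoef 1 v) 0 ∈ W.ge 2 := by
    rw [W.expOp_of_mem_zero v (zero_mem _)]
    exact zero_mem _
  rw [hs]
  refine Finset.sum_induction _ (fun x ↦ expOp (-A.ncoef 1 v) x ∈ W.ge 2)
    (fun x y hx hy ↦ by rw [haut.map_add]; exact add_mem hx hy) hzero fun i _ ↦ ?_
  by_cases hi0 : i = 0
  · subst hi0; rwa [h0]
  by_cases hi1 : i = 1
  · subst hi1; rwa [h1]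
  obtain ⟨y, hy⟩ := W.exists_eq_T hi0 hi1 (W.toGradedVA.pr_mem i b) (W.ncoef_zero_pr hb i)
  rw [hy, haut.map_T]
  exact W.T_mem_ge_two _

end J1

end VOACFT

/-- Lemma `J1`: in a VOA of CFT type, for any conformal vector `a`,
`pr_1(a) ∈ J_1(V)` and `exp(-pr_1(a)(1)) a ∈ V_{≥2} ∩ CV`. -/
theorem pr1_mem_J1_and_exp_conformal {K V : Type*} [RCLike K]
    [AddCommGroup V] [Module K V]
    (A : VA K V) (W : VOACFT A) (a : V) (ha : A.IsConformal a) :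
    W.pr 1 a ∈ W.J1 ∧
    expOp (-(A.ncoef 1 (W.pr 1 a))) a ∈ W.ge 2 ∧
    A.IsConformal (expOp (-(A.ncoef 1 (W.pr 1 a))) a) := by
  unfold VOACFT.pr ConfGVA.pr
  have hb : A.ncoef 0 (a - W.ω) = 0 := by
    rw [map_sub, ha.2.2.2.2.1, W.Lneg1_eq_T, sub_self]
  have hpr : ∀ i : ℤ, i ≠ 2 → W.toGradedVA.pr i (a - W.ω) = W.toGradedVA.pr i a := fun i hi ↦ by
    rw [W.toGradedVA.pr_sub, W.toGradedVA.pr_of_mem_ne W.ω_mem hi.symm, sub_zero]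
  have hv : W.toGradedVA.pr 1 a ∈ W.J1 :=
    ⟨W.toGradedVA.pr_mem 1 a, hpr 1 (by norm_num) ▸ W.ncoef_zero_pr hb 1⟩
  have h0 : A.ncoef 0 (W.toGradedVA.pr 0 a) = 0 := hpr 0 (by norm_num) ▸ W.ncoef_zero_pr hb 0
  have haut := W.expOp_isVAAut hv
  refine ⟨hv, ?_, haut.isConformal ha⟩
  have hvv : A.ncoef 1 (W.toGradedVA.pr 1 a) (W.toGradedVA.pr 1 a)
      = (2 : K) • W.toGradedVA.pr 0 a := by
    rw [← W.pr_zero_ncoef_one, ha.1, two_smul, two_smul, W.toGradedVA.pr_add]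
  have hmem0 := W.toGradedVA.pr_mem 0 a
  have hrest : expOp (-(A.ncoef 1 (W.toGradedVA.pr 1 a)))
      (a - W.ω - W.toGradedVA.pr 0 a - W.toGradedVA.pr 1 a) ∈ W.ge 2 := by
    refine W.expOp_mem_ge_two hv ?_ ?_ ?_
    · rw [map_sub, map_sub, hb, h0, hv.2, sub_zero, sub_zero]
    · rw [W.toGradedVA.pr_sub, W.toGradedVA.pr_sub, hpr 0 (by norm_num),
        W.toGradedVA.pr_of_mem hmem0, W.toGradedVA.pr_of_mem_ne hv.1 (by norm_num),
        sub_self, sub_zero]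
    · rw [W.toGradedVA.pr_sub, W.toGradedVA.pr_sub, hpr 1 (by norm_num),
        W.toGradedVA.pr_of_mem_ne hmem0 (by norm_num), W.toGradedVA.pr_of_mem hv.1,
        sub_zero, sub_self]
  have hdecomp : a = W.ω + W.toGradedVA.pr 0 a + W.toGradedVA.pr 1 a
      + (a - W.ω - W.toGradedVA.pr 0 a - W.toGradedVA.pr 1 a) := by abel
  have hexp : expOp (-(A.ncoef 1 (W.toGradedVA.pr 1 a))) a
      = W.ω + expOp (-(A.ncoef 1 (W.toGradedVA.pr 1 a)))
        (a - W.ω - W.toGradedVA.pr 0 a - W.toGradedVA.pr 1 a) := by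
    refine (congrArg _ hdecomp).trans ?_
    rw [haut.1.map_add, haut.1.map_add, haut.1.map_add, W.expOp_omega hv,
      W.expOp_of_mem_zero _ hmem0, W.expOp_self hv, hvv]
    module
  rw [hexp]
  exact add_mem (W.gr_le_ge le_rfl W.ω_mem) hrest
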